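/- Let (U,·,ω) be a symplectic associative algebra. Then the subspace J = U² + (U²)^⊥ is a two-sided ideal of U satisfying J·J = 0, where U² is the span of all products and (U²)^⊥ is the ω-orthogonal of U². -/

import Mathlib

variable {k U : Type*} [Field k] [AddCommGroup U] [Module k U]

/-- `U²`: the span of all products. -/
def squareIdeal (mul : U →ₗ[k] U →ₗ[k] U) : Submodule k U :=
  Submodule.span k {w | ∃ u v : U, w = mul u v}

/-- The ω-orthogonal of a subspace. -/
def omegaPerp (ω : U →ₗ[k] U →ₗ[k] k) (N : Submodule k U) : Submodule k U :=
  ⨅ p ∈ N, LinearMap.ker (ω.flip p)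

/-- In a symplectic associative algebra, `J = U² + (U²)^⊥` is a two-sided ideal
with `J·J = 0`. -/
theorem symplectic_associative_ideal
    {k U : Type*} [Field k] [CharZero k] [AddCommGroup U] [Module k U]
    [FiniteDimensional k U]
    (mul : U →ₗ[k] U →ₗ[k] U)
    (hassoc : ∀ u v w : U, mul (mul u v) w = mul u (mul v w))
    (ω : U →ₗ[k] U →ₗ[k] k)
    (hskew : ∀ u v : U, ω u v = - ω v u)
    (hnd : ∀ u : U, (∀ v : U, ω u v = 0) → u = 0)
    (hinv : ∀ u v w : U, ω (mul u v) w + ω v (mul u w) = 0) :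
    (∀ x ∈ squareIdeal mul ⊔ omegaPerp ω (squareIdeal mul), ∀ u : U,
      mul u x ∈ squareIdeal mul ⊔ omegaPerp ω (squareIdeal mul) ∧
      mul x u ∈ squareIdeal mul ⊔ omegaPerp ω (squareIdeal mul)) ∧
    (∀ x ∈ squareIdeal mul ⊔ omegaPerp ω (squareIdeal mul),
      ∀ y ∈ squareIdeal mul ⊔ omegaPerp ω (squareIdeal mul), mul x y = 0) := by
  have hL : ∀ u v w : U, mul u (mul v w) = - mul v (mul u w) := by
    intro u v w
    rw [← sub_eq_zero, sub_neg_eq_add]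
    apply hnd
    intro z
    have h1 := hinv u (mul v w) z
    have h2 := hinv v w (mul u z)
    have h3 := hinv (mul v u) w z
    rw [hassoc, hassoc] at h3
    rw [map_add, LinearMap.add_apply]
    linear_combination h1 - h2 + h3
  have h4 : ∀ a b c d : U, mul a (mul b (mul c d)) = 0 := by
    intro a b c d
    have h1 : mul a (mul b (mul c d)) = - mul b (mul c (mul a d)) := by
      have := hL a (mul b c) d
      rwa [hassoc, hassoc] at this
    have h2 : mul a (mul b (mul c d)) = mul b (mul c (mul a d)) := by
      rw [hL a b, hL a c, map_neg, neg_neg]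
    have h5 : (2 : k) • mul a (mul b (mul c d)) = 0 := by
      rw [two_smul]
      nth_rewrite 1 [h1]
      rw [h2, neg_add_cancel]
    exact (smul_eq_zero.mp h5).resolve_left two_ne_zero
  have hsq : ∀ u v : U, mul u v ∈ squareIdeal mul := fun u v =>
    Submodule.subset_span ⟨u, v, rfl⟩
  have hperp : ∀ y ∈ omegaPerp ω (squareIdeal mul), ∀ u : U, mul u y = 0 := by
    intro y hy u
    apply hnd
    intro w
    have h1 := hinv u y w
    have h2 : ω y (mul u w) = 0 := by
      simp only [omegaPerp, Submodule.mem_iInf, LinearMap.mem_ker, LinearMap.flip_apply] at hy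
      exact hy _ (hsq u w)
    rwa [h2, add_zero] at h1
  refine ⟨fun x _ u => ⟨Submodule.mem_sup_left (hsq u x), Submodule.mem_sup_left (hsq x u)⟩, ?_⟩
  have hx : ∀ x ∈ squareIdeal mul ⊔ omegaPerp ω (squareIdeal mul),
      ∀ c d : U, mul x (mul c d) = 0 := by
    intro x hx c d
    obtain ⟨a, ha, b, hb, rfl⟩ := Submodule.mem_sup.mp hx
    have h1 : mul a (mul c d) = 0 := by
      have hle : squareIdeal mul ≤ LinearMap.ker (mul.flip (mul c d)) := by
        refine Submodule.span_le.mpr ?_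
        rintro _ ⟨u, v, rfl⟩
        simp [hassoc, h4]
      simpa using hle ha
    have h2 : mul b (mul c d) = 0 := by
      rw [hL, ← hassoc, hperp b hb]
      simp
    rw [map_add, LinearMap.add_apply, h1, h2, add_zero]
  intro x hxJ y hy
  obtain ⟨a, ha, b, hb, rfl⟩ := Submodule.mem_sup.mp hy
  have hle : squareIdeal mul ≤ LinearMap.ker (mul x) := by
    refine Submodule.span_le.mpr ?_
    rintro _ ⟨u, v, rfl⟩
    simpa using hx x hxJ u v
  have h1 : mul x a = 0 := by simpa using hle ha
  rw [map_add, h1, hperp b hb, add_zero]
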